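/- Let G be a countable group and ρ : G → Homeo₊(S¹) a homomorphism. Suppose I ⊆ S¹ is a nonempty connected subset such that every point x ∈ I has trivial stabilizer under ρ. Then for any two points x, y ∈ I, the circular order on G induced by the orbit of x equals the circular order on G induced by the orbit of y. -/

import Mathlib

noncomputable section

open Classical in
/-- The circle `ℝ/ℤ`. -/
abbrev S1 : Type := AddCircle (1 : ℝ)

/-- The canonical representative of a point of the circle in `[0,1)`. -/
noncomputable def S1.rep (x : S1) : ℝ := (AddCircle.equivIco 1 0 x : ℝ)

open Classical in
/-- The orientation cocycle on the circle: `1` on positively oriented (counterclockwise)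
triples of pairwise distinct points, `-1` on negatively oriented ones, `0` otherwise. -/
noncomputable def circOrd (x y z : S1) : ℤ :=
  if x = y ∨ y = z ∨ x = z then 0
  else if (S1.rep x < S1.rep y ∧ S1.rep y < S1.rep z) ∨
      (S1.rep y < S1.rep z ∧ S1.rep z < S1.rep x) ∨
      (S1.rep z < S1.rep x ∧ S1.rep x < S1.rep y) then 1 else -1

/-- The group `Homeo₊(S¹)` of orientation preserving homeomorphisms of the circle, realized
as the subgroup of bijections of `S¹` which are homeomorphisms and preserve the orientation
cocycle. -/
noncomputable def HomeoPos : Subgroup (Equiv.Perm S1) where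
  carrier := {f | Continuous f ∧ Continuous f.symm ∧
    ∀ x y z, circOrd (f x) (f y) (f z) = circOrd x y z}
  one_mem' := ⟨by simpa using continuous_id, by exact continuous_id, by simp⟩
  mul_mem' := by
    rintro a b ⟨ha1, ha2, ha3⟩ ⟨hb1, hb2, hb3⟩
    refine ⟨?_, ?_, ?_⟩
    · have : ⇑(a * b) = ⇑a ∘ ⇑b := by ext x; simp [Equiv.Perm.mul_apply]
      rw [this]; exact ha1.comp hb1
    · have : ⇑(a * b).symm = ⇑b.symm ∘ ⇑a.symm := by
        ext x; rfl
      rw [this]; exact hb2.comp ha2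
    · intro x y z
      simp only [Equiv.Perm.mul_apply]
      rw [ha3, hb3]
  inv_mem' := by
    rintro a ⟨ha1, ha2, ha3⟩
    refine ⟨ha2, by exact ha1, ?_⟩
    intro x y z
    have := ha3 (a⁻¹ x) (a⁻¹ y) (a⁻¹ z)
    simpa using this.symm

/-- The action of an element of `Homeo₊(S¹)` on the circle. -/
def ap (h : ↥HomeoPos) (x : S1) : S1 := h.1 x

lemma ap_one (x : S1) : ap 1 x = x := rfl

lemma ap_mul (h₁ h₂ : ↥HomeoPos) (x : S1) : ap (h₁ * h₂) x = ap h₁ (ap h₂ x) := rfl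

variable {G : Type*} [Group G]

/-- A (left-invariant) circular order on a group `G`: a function `G³ → {-1,0,1}` vanishing
exactly on degenerate triples, satisfying the cocycle identity, and left-invariant. -/
def IsCircularOrder (c : G → G → G → ℤ) : Prop :=
  (∀ a b d, c a b d = 0 ↔ a = b ∨ b = d ∨ a = d) ∧
  (∀ a b d, c a b d = 1 ∨ c a b d = 0 ∨ c a b d = -1) ∧
  (∀ g₁ g₂ g₃ g₄, c g₂ g₃ g₄ - c g₁ g₃ g₄ + c g₁ g₂ g₄ - c g₁ g₂ g₃ = 0) ∧
  (∀ g u v w, c (g * u) (g * v) (g * w) = c u v w)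

/-- `c` is an isolated point of the space `CO(G)` of circular orders on `G` (with the
topology induced from the product topology on `{-1,0,1}^{G³}`): some basic neighborhood,
determined by agreement on a finite subset of `G`, contains only `c`. -/
def IsIsolatedCO (c : G → G → G → ℤ) : Prop :=
  ∃ S : Finset G, ∀ c' : G → G → G → ℤ, IsCircularOrder c' →
    (∀ u ∈ S, ∀ v ∈ S, ∀ w ∈ S, c' u v w = c u v w) → c' = c

/-- The basepoint `x₀` has trivial stabilizer under the action `ρ`. -/
def TrivialStabilizer (ρ : G →* ↥HomeoPos) (x₀ : S1) : Prop :=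
  ∀ g : G, ap (ρ g) x₀ = x₀ → g = 1

/-- The circular order on `G` induced by the orbit of a point `x₀` with trivial stabilizer. -/
def inducedCO (ρ : G →* ↥HomeoPos) (x₀ : S1) (g₁ g₂ g₃ : G) : ℤ :=
  circOrd (ap (ρ g₁) x₀) (ap (ρ g₂) x₀) (ap (ρ g₃) x₀)

/-- A continuous degree-one monotone map of the circle: a continuous surjection which
weakly preserves the orientation cocycle. -/
def DegOneMonotone (f : S1 → S1) : Prop :=
  Continuous f ∧ Function.Surjective f ∧
    ∀ x y z, f x ≠ f y → f y ≠ f z → f x ≠ f z → circOrd (f x) (f y) (f z) = circOrd x y z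

/-- `ρ` is a dynamical realization of the circular order `c` with basepoint `x₀`. -/
def IsDynamicalRealization (ρ : G →* ↥HomeoPos) (x₀ : S1) (c : G → G → G → ℤ) : Prop :=
  TrivialStabilizer ρ x₀ ∧
  (∀ g₁ g₂ g₃, inducedCO ρ x₀ g₁ g₂ g₃ = c g₁ g₂ g₃) ∧
  ∀ ρ' : G →* ↥HomeoPos, TrivialStabilizer ρ' x₀ →
    (∀ g₁ g₂ g₃, inducedCO ρ' x₀ g₁ g₂ g₃ = c g₁ g₂ g₃) →
    ∃ f : S1 → S1, DegOneMonotone f ∧ f x₀ = x₀ ∧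
      ∀ g : G, (ap (ρ g)) ∘ f = f ∘ (ap (ρ' g))

end
noncomputable section
variable {G : Type*} [Group G]

lemma S1.rep_mem (x : S1) : 0 ≤ S1.rep x ∧ S1.rep x < 1 := by
  have h := (AddCircle.equivIco 1 0 x).2
  simp only [Set.mem_Ico, zero_add] at h
  exact h

lemma S1.coe_rep (x : S1) : ((S1.rep x : ℝ) : S1) = x :=
  (AddCircle.equivIco 1 0).symm_apply_apply x

lemma S1.rep_eq {x : S1} {r : ℝ} (h0 : 0 ≤ r) (h1 : r < 1) (h : (r : S1) = x) :
    S1.rep x = r := by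
  have : (AddCircle.equivIco (1:ℝ) 0).symm ⟨r, by simpa using ⟨h0, h1⟩⟩ = x := h
  rw [Equiv.symm_apply_eq] at this
  rw [S1.rep, ← this]

lemma S1.rep_inj {x y : S1} (h : S1.rep x = S1.rep y) : x = y := by
  rw [← S1.coe_rep x, h, S1.coe_rep]

lemma S1.rep_sub (x y : S1) : S1.rep (y - x) =
    if S1.rep x ≤ S1.rep y then S1.rep y - S1.rep x else S1.rep y - S1.rep x + 1 := by
  have hx := S1.rep_mem x
  have hy := S1.rep_mem y
  split_ifs with h
  · apply S1.rep_eq (by linarith) (by linarith)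
    rw [AddCircle.coe_sub, S1.coe_rep, S1.coe_rep]
  · apply S1.rep_eq (by linarith) (by linarith)
    rw [AddCircle.coe_add, AddCircle.coe_sub, S1.coe_rep, S1.coe_rep, AddCircle.coe_period,
      add_zero]

lemma circOrd_eq {x y z : S1} (hxy : x ≠ y) (hyz : y ≠ z) (hxz : x ≠ z) :
    circOrd x y z = if S1.rep (y - x) < S1.rep (z - x) then 1 else -1 := by
  have hx := S1.rep_mem x
  have hy := S1.rep_mem y
  have hz := S1.rep_mem z
  have h1 : S1.rep x ≠ S1.rep y := fun h => hxy (S1.rep_inj h)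
  have h2 : S1.rep y ≠ S1.rep z := fun h => hyz (S1.rep_inj h)
  have h3 : S1.rep x ≠ S1.rep z := fun h => hxz (S1.rep_inj h)
  rw [circOrd, if_neg (by tauto), S1.rep_sub, S1.rep_sub]
  grind

lemma S1.rep_continuousAt {x : S1} (hx : x ≠ 0) : ContinuousAt S1.rep x := by
  have h := AddCircle.continuousAt_equivIco (1:ℝ) 0 (x := x) (by simpa using hx)
  exact continuous_subtype_val.continuousAt.comp h

lemma ap_continuous (h : ↥HomeoPos) : Continuous (ap h) := h.2.1

lemma ap_ne {ρ : G →* ↥HomeoPos} {x : S1} (hx : TrivialStabilizer ρ x) {a b : G}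
    (hab : a ≠ b) : ap (ρ a) x ≠ ap (ρ b) x := by
  intro h
  apply hab
  have : ap (ρ (b⁻¹ * a)) x = x := by
    rw [map_mul, ap_mul, h, ← ap_mul, ← map_mul, inv_mul_cancel, map_one, ap_one]
  exact (inv_mul_eq_one.1 (hx _ this)).symm

/-- **Change of basepoint within an interval of trivial stabilizers.**  If every point of a
nonempty connected set `I ⊆ S¹` has trivial stabilizer, then all basepoints in `I` induce
the same circular order on `G`. -/
theorem basepoint_constant_on_connected [Countable G]
    (ρ : G →* ↥HomeoPos) (I : Set S1) (hI : IsConnected I)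
    (hstab : ∀ x ∈ I, TrivialStabilizer ρ x) :
    ∀ x ∈ I, ∀ y ∈ I, ∀ g₁ g₂ g₃ : G,
      inducedCO ρ x g₁ g₂ g₃ = inducedCO ρ y g₁ g₂ g₃ := by
  intro x hx y hy a b c
  by_cases hd : a = b ∨ b = c ∨ a = c
  · unfold inducedCO circOrd
    rw [if_pos, if_pos] <;> rcases hd with rfl | rfl | rfl <;> simp
  push Not at hd
  obtain ⟨hab, hbc, hac⟩ := hd
  have cont : ∀ d, a ≠ d →
      ContinuousOn (fun t => S1.rep (ap (ρ d) t - ap (ρ a) t)) I := by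
    intro d had t ht
    have h1 : ContinuousAt S1.rep (ap (ρ d) t - ap (ρ a) t) :=
      S1.rep_continuousAt (sub_ne_zero.2 (ap_ne (hstab t ht) had.symm))
    have h2 : ContinuousAt (fun t => ap (ρ d) t - ap (ρ a) t) t :=
      ((ap_continuous _).sub (ap_continuous _)).continuousAt
    exact (ContinuousAt.comp (f := fun t => ap (ρ d) t - ap (ρ a) t) h1 h2).continuousWithinAt
  have hne : ∀ t ∈ I, S1.rep (ap (ρ b) t - ap (ρ a) t) ≠ S1.rep (ap (ρ c) t - ap (ρ a) t) :=
    fun t ht h => ap_ne (hstab t ht) hbc (sub_left_injective (S1.rep_inj h))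
  have key : ∀ s ∈ I, ∀ t ∈ I,
      S1.rep (ap (ρ b) s - ap (ρ a) s) < S1.rep (ap (ρ c) s - ap (ρ a) s) →
      S1.rep (ap (ρ b) t - ap (ρ a) t) < S1.rep (ap (ρ c) t - ap (ρ a) t) := by
    intro s hs t ht h
    by_contra hcon
    obtain ⟨u, hu, hu'⟩ := hI.isPreconnected.intermediate_value₂ hs ht (cont b hab) (cont c hac)
      h.le (not_lt.1 hcon)
    exact hne u hu hu'
  have e : ∀ t ∈ I, inducedCO ρ t a b c = if S1.rep (ap (ρ b) t - ap (ρ a) t) <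
      S1.rep (ap (ρ c) t - ap (ρ a) t) then 1 else -1 := fun t ht =>
    circOrd_eq (ap_ne (hstab t ht) hab) (ap_ne (hstab t ht) hbc) (ap_ne (hstab t ht) hac)
  rw [e x hx, e y hy]
  simp only [show (_ < _) ↔ (_ < _) from ⟨key x hx y hy, key y hy x hx⟩]

end
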